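/- arXiv:1411.1355 — 8 statements merged into one kernel-verified Lean document; each statement's English description precedes it below -/
import Mathlib

section
/- There exists r > 0, depending only on f, such that for every y = (y₁, y₂) in the open ball B_r(0) ⊂ ℝ², there is a unique s ∈ (−2r, 2r) satisfying (s − y₁) + f'(s)(f(s) − y₂) = 0. -/
open Real

/-- If `f` is `C²` with `f 0 = 0` and `f' 0 = 0`, then for small `c` the function
`s ↦ f' s * (f s - c)` is `1/4`-Lipschitz near `0`. -/
lemma exists_deriv_mul_sub_lipschitz {f : ℝ → ℝ} (hf : ContDiff ℝ 2 f) (hf0 : f 0 = 0)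
    (hf'0 : deriv f 0 = 0) :
    ∃ r > 0, ∀ c : ℝ, |c| < r → ∀ s ∈ Set.Icc (-(2 * r)) (2 * r),
      ∀ t ∈ Set.Icc (-(2 * r)) (2 * r),
        |deriv f t * (f t - c) - deriv f s * (f s - c)| ≤ 1 / 4 * |t - s| := by
  have hf' : ContDiff ℝ 1 (deriv f) :=
    (contDiff_succ_iff_deriv.1 (by simpa [one_add_one_eq_two] using hf : ContDiff ℝ (1 + 1) f)).2.2
  have hf'' : Continuous (deriv (deriv f)) := hf'.continuous_deriv le_rfl
  have hd : Differentiable ℝ f := hf.differentiable (by norm_num)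
  have hd' : Differentiable ℝ (deriv f) := hf'.differentiable (by norm_num)
  have hcont : Continuous fun p : ℝ × ℝ =>
      deriv (deriv f) p.1 * (f p.1 - p.2) + deriv f p.1 * deriv f p.1 := by
    have := hd.continuous
    have := hd'.continuous
    fun_prop
  obtain ⟨δ, hδ, h⟩ := Metric.continuous_iff.1 hcont (0, 0) (1 / 4) (by norm_num)
  refine ⟨δ / 3, by positivity, fun c hc s hs t ht => ?_⟩
  refine (convex_Icc (-(2 * (δ / 3))) (2 * (δ / 3))).norm_image_sub_le_of_norm_hasDerivWithin_le
    (f := fun s => deriv f s * (f s - c))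
    (f' := fun s => deriv (deriv f) s * (f s - c) + deriv f s * deriv f s)
    (fun x _ => ((hd' x).hasDerivAt.mul ((hd x).hasDerivAt.sub_const c)).hasDerivWithinAt)
    (fun x hx => ?_) hs ht
  have hx' : |x| < δ := by
    rw [abs_lt]
    constructor <;> linarith [hx.1, hx.2]
  have hdist : dist (x, c) ((0, 0) : ℝ × ℝ) < δ := by
    simp only [Prod.dist_eq, Real.dist_eq, sub_zero]
    exact max_lt hx' (by linarith)
  have := h (x, c) hdist
  simp only [hf0, hf'0, Real.dist_eq, sub_zero, mul_zero, add_zero] at this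
  exact this.le

/-- **Lemma 1 (existence and uniqueness).**
`f : ℝ → ℝ` is `C³` with `f 0 = 0` and `f' 0 = 0`.  There exists `r > 0`,
depending only on `f`, such that for every `y = (y₁, y₂)` in the open ball
`B_r(0) ⊆ ℝ²` there is a unique `s ∈ (−2r, 2r)` satisfying
`(s − y₁) + f'(s) (f s − y₂) = 0`. -/
theorem lemma1_existence_uniqueness
    (f : ℝ → ℝ) (hf : ContDiff ℝ 3 f) (hf0 : f 0 = 0) (hf'0 : deriv f 0 = 0) :
    ∃ r > 0, ∀ y ∈ Metric.ball (0 : EuclideanSpace ℝ (Fin 2)) r,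
      ∃! s : ℝ, s ∈ Set.Ioo (-(2 * r)) (2 * r) ∧
        (s - y 0) + deriv f s * (f s - y 1) = 0 := by
  obtain ⟨r, hr, h⟩ := exists_deriv_mul_sub_lipschitz (hf.of_le (by norm_num)) hf0 hf'0
  refine ⟨r, hr, fun y hy => ?_⟩
  have hcoord (i : Fin 2) : |y i| < r :=
    (PiLp.norm_apply_le y i).trans_lt (mem_ball_zero_iff.1 hy)
  have hlip := h (y 1) (hcoord 1)
  obtain ⟨hy₁, hy₂⟩ := abs_lt.1 (hcoord 0)
  have hcont : Continuous fun s => (s - y 0) + deriv f s * (f s - y 1) := by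
    have := hf.continuous
    have := hf.continuous_deriv (by norm_num)
    fun_prop
  have hzero : (0 : ℝ) ∈ Set.Icc (-(2 * r)) (2 * r) := ⟨by linarith, by linarith⟩
  have hright := hlip 0 hzero (2 * r) ⟨by linarith, le_rfl⟩
  have hleft := hlip 0 hzero (-(2 * r)) ⟨le_rfl, by linarith⟩
  rw [hf'0, zero_mul, sub_zero, sub_zero, abs_of_pos (by linarith : 0 < 2 * r), abs_le] at hright
  rw [hf'0, zero_mul, sub_zero, sub_zero, abs_neg, abs_of_pos (by linarith : 0 < 2 * r),
    abs_le] at hleft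
  obtain ⟨s, hs, hs0⟩ := intermediate_value_Ioo (by linarith : -(2 * r) ≤ 2 * r)
    hcont.continuousOn (show (0 : ℝ) ∈ _ from
      ⟨by linarith [hleft.2], by linarith [hright.1]⟩)
  refine ⟨s, ⟨hs, hs0⟩, fun t ⟨ht, ht0⟩ => ?_⟩
  have hst := hlip s (Set.Ioo_subset_Icc_self hs) t (Set.Ioo_subset_Icc_self ht)
  have heq : deriv f t * (f t - y 1) - deriv f s * (f s - y 1) = -(t - s) := by
    dsimp only at hs0
    linarith
  rw [heq, abs_neg] at hst
  exact sub_eq_zero.1 (abs_eq_zero.1 (le_antisymm (by linarith) (abs_nonneg _)))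
end

section
/- There exists r > 0, depending only on f, such that the map s : B_r(0) → (−2r, 2r) defined implicitly by the equation (s(y) − y₁) + f'(s(y))(f(s(y)) − y₂) = 0 (which has a unique solution s(y) ∈ (−2r, 2r) for each y ∈ B_r(0)) is of class C² on B_r(0). -/
open Real

/-- A function `S` picking out, for each `y ∈ U`, the unique zero in `I` of the `Cⁿ` function
`t ↦ F (y, t)` is itself `Cⁿ` on `U`, provided the partial derivative of `F` in the last variable
does not vanish at these zeros. -/
theorem contDiffOn_of_unique_zero {E : Type*} [NormedAddCommGroup E] [NormedSpace ℝ E]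
    [CompleteSpace E] {n : WithTop ℕ∞} (hn : n ≠ 0) {F : E × ℝ → ℝ} (hF : ContDiff ℝ n F)
    {U : Set E} {I : Set ℝ} (hU : IsOpen U) (hI : IsOpen I) {S : E → ℝ}
    (hSI : ∀ y ∈ U, S y ∈ I) (hS : ∀ y ∈ U, F (y, S y) = 0)
    (hS_unique : ∀ y ∈ U, ∀ t ∈ I, F (y, t) = 0 → t = S y)
    (hF' : ∀ y ∈ U, deriv (fun t => F (y, t)) (S y) ≠ 0) :
    ContDiffOn ℝ n S U := by
  intro y hy
  have cdf : ContDiffAt ℝ n F (y, S y) := hF.contDiffAt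
  have hpartial : HasDerivAt (fun t => F (y, t))
      ((fderiv ℝ F (y, S y) ∘L .inr ℝ E ℝ) 1) (S y) := by
    have hFd : HasFDerivAt F (fderiv ℝ F (y, S y)) (y, S y) :=
      (cdf.differentiableAt hn).hasFDerivAt
    exact (hFd.comp (S y) (hasFDerivAt_prodMk_right y (S y))).hasDerivAt
  have hinv : (fderiv ℝ F (y, S y) ∘L .inr ℝ E ℝ).IsInvertible := by
    have h0 := hF' y hy
    rw [hpartial.deriv] at h0
    refine ⟨ContinuousLinearEquiv.unitsEquivAut ℝ (Units.mk0 _ h0), ?_⟩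
    ext
    simp
  have hψ := cdf.contDiffAt_implicitFunction hn hinv
  have hψ0 := cdf.implicitFunction_apply_self hn hinv
  have hψI : ∀ᶠ x in nhds y, cdf.implicitFunction hn hinv x ∈ I :=
    hψ.continuousAt.eventually_mem (by
      rw [hψ0]
      exact hI.mem_nhds (hSI y hy))
  refine (hψ.congr_of_eventuallyEq ?_).contDiffWithinAt
  filter_upwards [hψI, cdf.eventually_apply_implicitFunction hn hinv, hU.mem_nhds hy]
    with x hxI hx hxU
  exact (hS_unique x hxU _ hxI (hx.trans (hS y hy))).symm

/-- **Lemma 1 (regularity of the implicit map).**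
`f : ℝ → ℝ` is `C³` with `f 0 = 0` and `f' 0 = 0`.  There exists `r > 0`,
depending only on `f`, such that the map `s : B_r(0) → (−2r, 2r)` defined
implicitly by `(s(y) − y₁) + f'(s(y)) (f (s(y)) − y₂) = 0` (the unique solution
in `(−2r, 2r)` for each `y ∈ B_r(0)`) is of class `C²` on `B_r(0)`. -/
theorem lemma1_C2_regularity
    (f : ℝ → ℝ) (hf : ContDiff ℝ 3 f) (hf0 : f 0 = 0) (hf'0 : deriv f 0 = 0) :
    ∃ r > 0, ∃ S : EuclideanSpace ℝ (Fin 2) → ℝ,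
      (∀ y ∈ Metric.ball (0 : EuclideanSpace ℝ (Fin 2)) r,
        S y ∈ Set.Ioo (-(2 * r)) (2 * r) ∧
        (S y - y 0) + deriv f (S y) * (f (S y) - y 1) = 0 ∧
        ∀ s ∈ Set.Ioo (-(2 * r)) (2 * r),
          (s - y 0) + deriv f s * (f s - y 1) = 0 → s = S y) ∧
      ContDiffOn ℝ 2 S (Metric.ball 0 r) := by
  have hf' : ContDiff ℝ 2 (deriv f) := (contDiff_succ_iff_deriv (n := 2).1 hf).2.2
  have hf'' : Continuous (deriv (deriv f)) := hf'.continuous_deriv (by norm_num)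
  let F : EuclideanSpace ℝ (Fin 2) × ℝ → ℝ :=
    fun p => (p.2 - p.1 0) + deriv f p.2 * (f p.2 - p.1 1)
  let F' : EuclideanSpace ℝ (Fin 2) × ℝ → ℝ :=
    fun p => 1 + (deriv (deriv f) p.2 * (f p.2 - p.1 1) + deriv f p.2 * deriv f p.2)
  have hF : ContDiff ℝ 2 F := by
    have := hf.of_le (show (2 : WithTop ℕ∞) ≤ 3 by norm_num)
    fun_prop
  have hF'_cont : Continuous F' := by
    have := hf.continuous
    have := hf'.continuous
    fun_prop
  have hFd (y : EuclideanSpace ℝ (Fin 2)) (t : ℝ) :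
      HasDerivAt (fun t => F (y, t)) (F' (y, t)) t := by
    have h1 := (hf.differentiable (by norm_num) t).hasDerivAt
    have h2 := (hf'.differentiable (by norm_num) t).hasDerivAt
    exact ((hasDerivAt_id t).sub_const (y 0)).add (h2.mul (h1.sub_const (y 1)))
  have hF'0 : (1 / 2 : ℝ) < F' 0 := by
    simp only [F', Prod.fst_zero, Prod.snd_zero, hf0, hf'0, PiLp.zero_apply]
    norm_num
  obtain ⟨ε, hε, hball⟩ := Metric.eventually_nhds_iff.1
    (hF'_cont.continuousAt.eventually_const_lt hF'0)
  obtain ⟨r, hr, hrε⟩ : ∃ r > 0, 2 * r < ε := ⟨ε / 3, by positivity, by linarith⟩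
  have hF'_gt : ∀ y ∈ Metric.ball (0 : EuclideanSpace ℝ (Fin 2)) r,
      ∀ t ∈ Set.Icc (-(2 * r)) (2 * r), 1 / 2 < F' (y, t) := by
    intro y hy t ht
    rw [mem_ball_zero_iff] at hy
    apply hball
    rw [dist_zero_right, Prod.norm_def, max_lt_iff]
    exact ⟨by linarith, (abs_le.2 ht).trans_lt hrε⟩
  have hgrowth : ∀ y ∈ Metric.ball (0 : EuclideanSpace ℝ (Fin 2)) r,
      ∀ a ∈ Set.Icc (-(2 * r)) (2 * r), ∀ b ∈ Set.Icc (-(2 * r)) (2 * r), a ≤ b →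
        1 / 2 * (b - a) ≤ F (y, b) - F (y, a) := by
    intro y hy
    refine (convex_Icc (-(2 * r)) (2 * r)).mul_sub_le_image_sub_of_le_deriv
      (fun t _ => (hFd y t).continuousAt.continuousWithinAt)
      (fun t _ => (hFd y t).differentiableAt.differentiableWithinAt) fun t ht => ?_
    rw [(hFd y t).deriv]
    exact (hF'_gt y hy t (interior_subset ht)).le
  have hexists : ∀ y ∈ Metric.ball (0 : EuclideanSpace ℝ (Fin 2)) r,
      ∃ s ∈ Set.Ioo (-(2 * r)) (2 * r), F (y, s) = 0 := by
    intro y hy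
    have hy0 := abs_lt.1 ((PiLp.norm_apply_le y 0).trans_lt (mem_ball_zero_iff.1 hy))
    have hFy : F (y, 0) = -y 0 := by simp [F, hf'0]
    have hright := hgrowth y hy 0 ⟨by linarith, by linarith⟩ (2 * r)
      ⟨by linarith, le_rfl⟩ (by linarith)
    have hleft := hgrowth y hy (-(2 * r)) ⟨le_rfl, by linarith⟩ 0
      ⟨by linarith, by linarith⟩ (by linarith)
    exact intermediate_value_Ioo (f := fun t => F (y, t)) (by linarith)
      (fun t _ => (hFd y t).continuousAt.continuousWithinAt)
      ⟨by linarith [hy0.1], by linarith [hy0.2]⟩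
  have hunique : ∀ y ∈ Metric.ball (0 : EuclideanSpace ℝ (Fin 2)) r,
      ∀ s ∈ Set.Ioo (-(2 * r)) (2 * r), ∀ t ∈ Set.Ioo (-(2 * r)) (2 * r),
        F (y, s) = 0 → F (y, t) = 0 → s = t := by
    intro y hy s hs t ht hFs hFt
    have hs' := Set.Ioo_subset_Icc_self hs
    have ht' := Set.Ioo_subset_Icc_self ht
    rcases le_total s t with hst | hst
    · linarith [hgrowth y hy s hs' t ht' hst]
    · linarith [hgrowth y hy t ht' s hs' hst]
  choose! S hSI hS using hexists
  refine ⟨r, hr, S, fun y hy => ⟨hSI y hy, hS y hy, fun s hs h =>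
    hunique y hy s hs (S y) (hSI y hy) h (hS y hy)⟩, ?_⟩
  refine contDiffOn_of_unique_zero two_ne_zero hF Metric.isOpen_ball isOpen_Ioo hSI hS
    (fun y hy t ht h => hunique y hy t ht (S y) (hSI y hy) h (hS y hy)) fun y hy => ?_
  rw [(hFd y (S y)).deriv]
  linarith [hF'_gt y hy (S y) (Set.Ioo_subset_Icc_self (hSI y hy))]
end

section
/- For every s₀ with |s₀| sufficiently small so that the point (s₀, f(s₀)) lies in B_r(0), the partial derivatives of the implicit map s at the boundary point y = (s₀, f(s₀)) are given by ∂s/∂y₁ = 1/(1 + f'(s₀)²) and ∂s/∂y₂ = f'(s₀)/(1 + f'(s₀)²). -/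
open Real

noncomputable section

/-- The point `(a, b)` of the Euclidean plane. -/
def pt (a b : ℝ) : EuclideanSpace ℝ (Fin 2) := (WithLp.equiv 2 (Fin 2 → ℝ)).symm ![a, b]

/-- The implicit equation defining `S`, differentiated at a point of the graph of `f`, where the term
containing the second derivative of `f` vanishes. -/
theorem one_add_deriv_sq_mul_fderiv {f : ℝ → ℝ} (hf : ContDiff ℝ 2 f)
    {S : EuclideanSpace ℝ (Fin 2) → ℝ} {p : EuclideanSpace ℝ (Fin 2)}
    (hS : DifferentiableAt ℝ S p) (hp : f (S p) = p 1)
    (h : ∀ᶠ y in nhds p, (S y - y 0) + deriv f (S y) * (f (S y) - y 1) = 0)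
    (v : EuclideanSpace ℝ (Fin 2)) :
    (1 + deriv f (S p) ^ 2) * fderiv ℝ S p v = v 0 + deriv f (S p) * v 1 := by
  have hf1 : HasDerivAt f (deriv f (S p)) (S p) :=
    (hf.differentiable (by norm_num) _).hasDerivAt
  have hf2 : HasDerivAt (deriv f) (deriv (deriv f) (S p)) (S p) :=
    ((hf.deriv' (n := 1)).differentiable (by norm_num) _).hasDerivAt
  have hcoord (i : Fin 2) : HasFDerivAt (fun y : EuclideanSpace ℝ (Fin 2) => y i)
      (EuclideanSpace.proj i : EuclideanSpace ℝ (Fin 2) →L[ℝ] ℝ) p :=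
    (EuclideanSpace.proj i : EuclideanSpace ℝ (Fin 2) →L[ℝ] ℝ).hasFDerivAt
  have hL := hS.hasFDerivAt
  have hF := (hL.sub (hcoord 0)).add ((hf2.comp_hasFDerivAt p hL).mul
    ((hf1.comp_hasFDerivAt p hL).sub (hcoord 1)))
  have hzero := hF.unique ((hasFDerivAt_const (0 : ℝ) p).congr_of_eventuallyEq h)
  have hv := DFunLike.congr_fun hzero v
  simp [hp] at hv
  linear_combination hv

/-- **Partial derivatives of the implicit map at boundary points.**
Let `f : ℝ → ℝ` be `C³` with `f 0 = 0`, `f' 0 = 0`, and let `r > 0` and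
`S : B_r(0) → (−2r, 2r)` be the unique `C²` implicit map of Lemma 1, i.e.
`(S y − y₁) + f'(S y) (f (S y) − y₂) = 0` on `B_r(0)`.  Then for every `s₀`
with `(s₀, f s₀) ∈ B_r(0)`, the partial derivatives of `S` at `y = (s₀, f s₀)`
are `∂S/∂y₁ = 1 / (1 + f'(s₀)²)` and `∂S/∂y₂ = f'(s₀) / (1 + f'(s₀)²)`. -/
theorem implicit_map_partial_derivs_at_boundary
    (f : ℝ → ℝ) (hf : ContDiff ℝ 3 f) (hf0 : f 0 = 0) (hf'0 : deriv f 0 = 0)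
    (r : ℝ) (hr : 0 < r) (S : EuclideanSpace ℝ (Fin 2) → ℝ)
    (hS : ∀ y ∈ Metric.ball (0 : EuclideanSpace ℝ (Fin 2)) r,
        S y ∈ Set.Ioo (-(2 * r)) (2 * r) ∧
        (S y - y 0) + deriv f (S y) * (f (S y) - y 1) = 0 ∧
        ∀ s ∈ Set.Ioo (-(2 * r)) (2 * r),
          (s - y 0) + deriv f s * (f s - y 1) = 0 → s = S y)
    (hS2 : ContDiffOn ℝ 2 S (Metric.ball 0 r)) :
    ∀ s₀ : ℝ, pt s₀ (f s₀) ∈ Metric.ball (0 : EuclideanSpace ℝ (Fin 2)) r →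
      fderiv ℝ S (pt s₀ (f s₀)) (EuclideanSpace.single 0 1)
          = 1 / (1 + deriv f s₀ ^ 2) ∧
      fderiv ℝ S (pt s₀ (f s₀)) (EuclideanSpace.single 1 1)
          = deriv f s₀ / (1 + deriv f s₀ ^ 2) := by
  intro s₀ hs₀
  have hp0 : pt s₀ (f s₀) 0 = s₀ := rfl
  have hp1 : pt s₀ (f s₀) 1 = f s₀ := rfl
  have habs : |s₀| < r := by
    have h := PiLp.norm_apply_le (pt s₀ (f s₀)) 0
    rw [hp0, Real.norm_eq_abs] at h
    exact h.trans_lt (mem_ball_zero_iff.mp hs₀)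
  have hSp : S (pt s₀ (f s₀)) = s₀ := by
    refine ((hS _ hs₀).2.2 s₀ ?_ ?_).symm
    · exact abs_lt.mp (by linarith)
    · simp [hp0, hp1]
  have hnhds := Metric.isOpen_ball.mem_nhds hs₀
  have key := one_add_deriv_sq_mul_fderiv (hf.of_le (by norm_num))
    ((hS2.contDiffAt hnhds).differentiableAt (by norm_num)) (by rw [hSp, hp1])
    (Filter.mem_of_superset hnhds fun y hy => (hS y hy).2.1)
  rw [hSp] at key
  have hne : 1 + deriv f s₀ ^ 2 ≠ 0 := by positivity
  constructor
  · rw [eq_div_iff hne, mul_comm, key]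
    simp
  · rw [eq_div_iff hne, mul_comm, key]
    simp
end
end

section
/- For every s₀ with (s₀, f(s₀)) ∈ B_r(0), the Jacobian matrix of the reflection map y ↦ y*(y) at the boundary point y = (s₀, f(s₀)) equals the matrix with rows ((1 − f'(s₀)²)/(1 + f'(s₀)²), 2f'(s₀)/(1 + f'(s₀)²)) and (2f'(s₀)/(1 + f'(s₀)²), (f'(s₀)² − 1)/(1 + f'(s₀)²)); in particular this matrix is an orthogonal reflection with determinant −1. -/
open Real

noncomputable section

@[simp] lemma pt_apply_zero (a b : ℝ) : pt a b 0 = a := by simp [pt]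

@[simp] lemma pt_apply_one (a b : ℝ) : pt a b 1 = b := by simp [pt]

lemma pt_eq_smul_single_add (a b : ℝ) :
    pt a b = a • EuclideanSpace.single 0 1 + b • EuclideanSpace.single 1 1 := by
  ext i
  fin_cases i <;> simp

/-- Implicit differentiation of the foot-point equation at a point of the graph of `f`. -/
lemma fderiv_foot_mul {f : ℝ → ℝ} (hf : ContDiff ℝ 2 f)
    {S : EuclideanSpace ℝ (Fin 2) → ℝ} {s₀ : ℝ}
    (hS : DifferentiableAt ℝ S (pt s₀ (f s₀))) (hs₀ : S (pt s₀ (f s₀)) = s₀)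
    (heq : ∀ᶠ y in nhds (pt s₀ (f s₀)),
      (S y - y 0) + deriv f (S y) * (f (S y) - y 1) = 0)
    (v : EuclideanSpace ℝ (Fin 2)) :
    fderiv ℝ S (pt s₀ (f s₀)) v * (1 + deriv f s₀ ^ 2) = v 0 + deriv f s₀ * v 1 := by
  set p := pt s₀ (f s₀) with hp
  have hfd : HasDerivAt f (deriv f s₀) (S p) := by
    rw [hs₀]
    exact (hf.differentiable (by norm_num) s₀).hasDerivAt
  have hfdd : HasDerivAt (deriv f) (deriv (deriv f) s₀) (S p) := by
    rw [hs₀]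
    exact (((contDiff_succ_iff_deriv (n := 1)).1 hf).2.2.differentiable
      (by norm_num) s₀).hasDerivAt
  have hproj (i : Fin 2) : HasFDerivAt (fun y : EuclideanSpace ℝ (Fin 2) => y i)
      (EuclideanSpace.proj i : EuclideanSpace ℝ (Fin 2) →L[ℝ] ℝ) p :=
    (EuclideanSpace.proj i : EuclideanSpace ℝ (Fin 2) →L[ℝ] ℝ).hasFDerivAt
  have hL := hS.hasFDerivAt
  have hF := (hL.sub (hproj 0)).add ((hfdd.comp_hasFDerivAt p hL).mul
    ((hfd.comp_hasFDerivAt p hL).sub (hproj 1)))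
  have hzero := hF.unique ((hasFDerivAt_const (0 : ℝ) p).congr_of_eventuallyEq heq)
  have h := congrArg (fun L => L v) hzero
  have hp1 : p 1 = f s₀ := by simp [hp]
  simp [hs₀, hp1] at h
  linear_combination h

/-- **Jacobian of the reflection map at boundary points.**
Let `f : ℝ → ℝ` be `C³` with `f 0 = 0`, `f' 0 = 0`, let `r > 0` and
`S : B_r(0) → (−2r, 2r)` be the unique `C²` implicit map of Lemma 1, and set
`e(y) = (S y, f (S y))`, `y*(y) = 2 e(y) − y`.  For every `s₀` with
`(s₀, f s₀) ∈ B_r(0)`, the Jacobian matrix of `y ↦ y*(y)` at `y = (s₀, f s₀)`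
equals the matrix with rows
`((1 − f'(s₀)²)/(1 + f'(s₀)²), 2 f'(s₀)/(1 + f'(s₀)²))` and
`(2 f'(s₀)/(1 + f'(s₀)²), (f'(s₀)² − 1)/(1 + f'(s₀)²))`;
in particular this matrix is an orthogonal reflection: `Mᵀ * M = 1` and
`det M = −1`. -/
theorem reflection_jacobian_at_boundary
    (f : ℝ → ℝ) (hf : ContDiff ℝ 3 f) (hf0 : f 0 = 0) (hf'0 : deriv f 0 = 0)
    (r : ℝ) (hr : 0 < r) (S : EuclideanSpace ℝ (Fin 2) → ℝ)
    (hS : ∀ y ∈ Metric.ball (0 : EuclideanSpace ℝ (Fin 2)) r,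
        S y ∈ Set.Ioo (-(2 * r)) (2 * r) ∧
        (S y - y 0) + deriv f (S y) * (f (S y) - y 1) = 0 ∧
        ∀ s ∈ Set.Ioo (-(2 * r)) (2 * r),
          (s - y 0) + deriv f s * (f s - y 1) = 0 → s = S y)
    (hS2 : ContDiffOn ℝ 2 S (Metric.ball 0 r))
    (ystar : EuclideanSpace ℝ (Fin 2) → EuclideanSpace ℝ (Fin 2))
    (hystar : ∀ y, ystar y = (2 : ℝ) • pt (S y) (f (S y)) - y) :
    ∀ s₀ : ℝ, pt s₀ (f s₀) ∈ Metric.ball (0 : EuclideanSpace ℝ (Fin 2)) r →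
      ∀ M : Matrix (Fin 2) (Fin 2) ℝ,
        M = !![(1 - deriv f s₀ ^ 2) / (1 + deriv f s₀ ^ 2),
               2 * deriv f s₀ / (1 + deriv f s₀ ^ 2);
               2 * deriv f s₀ / (1 + deriv f s₀ ^ 2),
               (deriv f s₀ ^ 2 - 1) / (1 + deriv f s₀ ^ 2)] →
        (∀ i j : Fin 2,
            fderiv ℝ ystar (pt s₀ (f s₀)) (EuclideanSpace.single j 1) i = M i j) ∧
        M.transpose * M = 1 ∧ M.det = -1 := by
  intro s₀ hmem M hM
  have hpos : 1 + deriv f s₀ ^ 2 ≠ 0 := by positivity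
  have hnhds := Metric.isOpen_ball.mem_nhds hmem
  have hs₀ : S (pt s₀ (f s₀)) = s₀ := by
    refine ((hS _ hmem).2.2 s₀ ?_ (by simp)).symm
    have h := (PiLp.norm_apply_le (pt s₀ (f s₀)) 0).trans_lt (mem_ball_zero_iff.1 hmem)
    rw [pt_apply_zero, Real.norm_eq_abs, abs_lt] at h
    constructor <;> linarith
  have hSd : DifferentiableAt ℝ S (pt s₀ (f s₀)) :=
    (hS2.contDiffAt hnhds).differentiableAt (by norm_num)
  have hL := fderiv_foot_mul (hf.of_le (by norm_num)) hSd hs₀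
    (Filter.mem_of_superset hnhds fun y hy => (hS y hy).2.1)
  have hfd : HasDerivAt f (deriv f s₀) (S (pt s₀ (f s₀))) := by
    rw [hs₀]
    exact (hf.differentiable (by norm_num) s₀).hasDerivAt
  have hstar : ystar = fun y => (2 : ℝ) • (S y • EuclideanSpace.single 0 1 +
      (f ∘ S) y • EuclideanSpace.single 1 1) - y := by
    funext y
    rw [hystar, pt_eq_smul_single_add, Function.comp_apply]
  have hder := (((hSd.hasFDerivAt.smul_const
    (EuclideanSpace.single 0 1 : EuclideanSpace ℝ (Fin 2))).add
    ((hfd.comp_hasFDerivAt _ hSd.hasFDerivAt).smul_const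
      (EuclideanSpace.single 1 1 : EuclideanSpace ℝ (Fin 2)))).const_smul (2 : ℝ)).sub
    (hasFDerivAt_id (pt s₀ (f s₀)))
  have hfderiv := (hder.congr_of_eventuallyEq (Filter.Eventually.of_forall
    fun y => congrFun hstar y)).fderiv
  have hL0 := eq_div_of_mul_eq hpos (hL (EuclideanSpace.single 0 1))
  have hL1 := eq_div_of_mul_eq hpos (hL (EuclideanSpace.single 1 1))
  refine ⟨fun i j => ?_, ?_, ?_⟩
  · rw [hfderiv, hM]
    fin_cases i <;> fin_cases j <;> simp [hL0, hL1] <;> field_simp <;> ring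
  · rw [hM]
    ext i j
    fin_cases i <;> fin_cases j <;>
      simp [Matrix.mul_apply, Fin.sum_univ_two] <;> field_simp <;> ring
  · rw [hM, Matrix.det_fin_two_of]
    field_simp
    ring
end
end

section
/- There exist r > 0 and C > 0, depending only on f, such that for all s₀ with |s₀| ≤ 2r and all y ∈ B_r(0): |y*₁(y) − s₀ − ((1 − f'(s₀)²)/(1 + f'(s₀)²))(y₁ − s₀) − (2f'(s₀)/(1 + f'(s₀)²))(y₂ − f(s₀))| ≤ C|y − (s₀, f(s₀))|² and |y*₂(y) − f(s₀) − (2f'(s₀)/(1 + f'(s₀)²))(y₁ − s₀) − ((f'(s₀)² − 1)/(1 + f'(s₀)²))(y₂ − f(s₀))| ≤ C|y − (s₀, f(s₀))|². -/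
open Real

noncomputable section

/-- If `deriv f` is `M`-Lipschitz on `[-a, a]`, the first-order Taylor remainder of `f` there is
at most `M * (s - t) ^ 2`. -/
lemma abs_sub_sub_deriv_mul_le {f : ℝ → ℝ} (hf : Differentiable ℝ f) {a M : ℝ} (hM : 0 ≤ M)
    (hL : ∀ x ∈ Set.Icc (-a) a, ∀ t ∈ Set.Icc (-a) a, |deriv f x - deriv f t| ≤ M * |x - t|)
    {s t : ℝ} (hs : s ∈ Set.Icc (-a) a) (ht : t ∈ Set.Icc (-a) a) :
    |f s - f t - deriv f t * (s - t)| ≤ M * (s - t) ^ 2 := by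
  have hd : ∀ x ∈ Set.uIcc t s,
      HasDerivWithinAt (fun x => f x - deriv f t * x) (deriv f x - deriv f t) (Set.uIcc t s) x := by
    intro x _
    have h := ((hf x).hasDerivAt.sub ((hasDerivAt_id x).const_mul (deriv f t))).hasDerivWithinAt
      (s := Set.uIcc t s)
    rwa [mul_one] at h
  have hb : ∀ x ∈ Set.uIcc t s, ‖deriv f x - deriv f t‖ ≤ M * |s - t| := by
    intro x hx
    have hxt : |x - t| ≤ |s - t| := Set.abs_sub_left_of_mem_uIcc hx
    exact (hL x (Set.uIcc_subset_Icc ht hs hx) t ht).trans (by gcongr)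
  have h := (convex_uIcc t s).norm_image_sub_le_of_norm_hasDerivWithin_le hd hb
    Set.left_mem_uIcc Set.right_mem_uIcc
  rw [Real.norm_eq_abs, Real.norm_eq_abs, mul_assoc, abs_mul_abs_self] at h
  calc |f s - f t - deriv f t * (s - t)|
      = |f s - deriv f t * s - (f t - deriv f t * t)| := by congr 1; ring
    _ ≤ M * (s - t) ^ 2 := by rw [pow_two]; exact h

/-- A `C²` function with `f' 0 = 0` has, on some interval around `0`, a derivative bounded by
`1 / 2` and Lipschitz. -/
lemma exists_deriv_bound_and_lipschitz {f : ℝ → ℝ} (hf : ContDiff ℝ 2 f) (hf'0 : deriv f 0 = 0) :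
    ∃ a M : ℝ, 0 < a ∧ 0 ≤ M ∧ (∀ x ∈ Set.Icc (-a) a, |deriv f x| ≤ 1 / 2) ∧
      ∀ x ∈ Set.Icc (-a) a, ∀ t ∈ Set.Icc (-a) a, |deriv f x - deriv f t| ≤ M * |x - t| := by
  have hf' : ContDiff ℝ 1 (deriv f) :=
    ((contDiff_succ_iff_deriv (n := 1)).1 (by simpa [one_add_one_eq_two] using hf)).2.2
  obtain ⟨K, T, hT, hK⟩ := hf'.contDiffAt.exists_lipschitzOnWith (x := 0)
  have hsmall : ∀ᶠ x in nhds (0 : ℝ), |deriv f x| < 1 / 2 :=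
    hf'.continuous.abs.continuousAt.eventually_lt continuousAt_const (by simp [hf'0])
  obtain ⟨a, ha, hball⟩ := Metric.nhds_basis_closedBall.mem_iff.1 (Filter.inter_mem hT hsmall)
  rw [Real.closedBall_eq_Icc, zero_sub, zero_add] at hball
  refine ⟨a, K, ha, K.2, fun x hx => (hball hx).2.le, fun x hx t ht => ?_⟩
  simpa [Real.dist_eq] using hK.dist_le_mul x (hball hx).1 t (hball ht).1

/-- Scalar form of the reflection expansion: `δ = s - s₀`, `F = f s - f s₀`, `p = f' s₀`,
`q = f' s`, and `(u, v)` is the displacement of `y` from `(s₀, f s₀)`. -/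
lemma reflection_expansion_scalar {δ F p q u v w M : ℝ} (hM : 0 ≤ M)
    (heq : δ - u + q * (F - v) = 0) (hp : |p| ≤ 1 / 2) (hq : |q| ≤ 1 / 2)
    (hpq : |q - p| ≤ M * |δ|) (hFδ : |F| ≤ 1 / 2 * |δ|) (hF : |F - p * δ| ≤ M * δ ^ 2)
    (hu : |u| ≤ w) (hv : |v| ≤ w) :
    |2 * δ - u - (1 - p ^ 2) / (1 + p ^ 2) * u - 2 * p / (1 + p ^ 2) * v| ≤ 14 * M * w ^ 2 ∧
    |2 * F - v - 2 * p / (1 + p ^ 2) * u - (p ^ 2 - 1) / (1 + p ^ 2) * v| ≤ 14 * M * w ^ 2 := by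
  have hw : 0 ≤ w := (abs_nonneg u).trans hu
  have hδ : |δ| ≤ 2 * w := by
    have h1 : |δ| ≤ |u| + |q| * (|F| + |v|) := by
      have h2 : δ = u - q * (F - v) := by linarith
      calc |δ| = |u - q * (F - v)| := by rw [← h2]
        _ ≤ |u| + |q * (F - v)| := abs_sub _ _
        _ ≤ |u| + |q| * (|F| + |v|) := by rw [abs_mul]; gcongr; exact abs_sub _ _
    have h3 : |q| * (|F| + |v|) ≤ 1 / 2 * (1 / 2 * |δ| + w) := by gcongr
    linarith
  have hδ2 : δ ^ 2 ≤ 4 * w ^ 2 := by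
    rw [← sq_abs δ]
    nlinarith [abs_nonneg δ]
  have hF' : |F - p * δ| ≤ 4 * M * w ^ 2 := by nlinarith
  have hpq' : |q - p| ≤ 2 * M * w := by nlinarith
  have hE : |δ * (1 + p ^ 2) - u - p * v| ≤ 6 * M * w ^ 2 := by
    have h1 : δ * (1 + p ^ 2) - u - p * v
        = (q - p) * v - q * (F - p * δ) - (q - p) * (p * δ) := by linear_combination heq
    have h2 : |(q - p) * v| ≤ 2 * M * w * w := by rw [abs_mul]; gcongr
    have h3 : |q * (F - p * δ)| ≤ 1 / 2 * (4 * M * w ^ 2) := by rw [abs_mul]; gcongr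
    have h4 : |(q - p) * (p * δ)| ≤ 2 * M * w * (1 / 2 * (2 * w)) := by
      rw [abs_mul, abs_mul]; gcongr
    rw [h1]
    calc _ ≤ |(q - p) * v| + |q * (F - p * δ)| + |(q - p) * (p * δ)| :=
          (abs_sub _ _).trans (by gcongr; exact abs_sub _ _)
      _ ≤ 6 * M * w ^ 2 := by linarith
  have hden : (1 : ℝ) ≤ 1 + p ^ 2 := by nlinarith [sq_nonneg p]
  have hdiv : |(δ * (1 + p ^ 2) - u - p * v) / (1 + p ^ 2)| ≤ 6 * M * w ^ 2 := by
    rw [abs_div, abs_of_pos (zero_lt_one.trans_le hden)]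
    exact (div_le_self (abs_nonneg _) hden).trans hE
  have hMw : 0 ≤ M * w ^ 2 := by positivity
  constructor
  · have h1 : 2 * δ - u - (1 - p ^ 2) / (1 + p ^ 2) * u - 2 * p / (1 + p ^ 2) * v
        = 2 * ((δ * (1 + p ^ 2) - u - p * v) / (1 + p ^ 2)) := by
      field_simp
      ring
    rw [h1, abs_mul, abs_two]
    linarith
  · have h1 : 2 * F - v - 2 * p / (1 + p ^ 2) * u - (p ^ 2 - 1) / (1 + p ^ 2) * v
        = 2 * (F - p * δ) + 2 * (p * ((δ * (1 + p ^ 2) - u - p * v) / (1 + p ^ 2))) := by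
      field_simp
      ring
    have h2 : |p * ((δ * (1 + p ^ 2) - u - p * v) / (1 + p ^ 2))| ≤ 1 / 2 * (6 * M * w ^ 2) := by
      rw [abs_mul]; gcongr
    rw [h1]
    refine (abs_add_le _ _).trans ?_
    rw [abs_mul, abs_mul, abs_two]
    linarith

/-- **Lemma 2 (first-order expansion of the reflection).**
With `f`, the implicit map `S` of Lemma 1 (defined on a ball of radius `r₀`),
`e(y) = (S y, f (S y))` and `y*(y) = 2 e(y) − y`: there exist `r > 0` and
`C > 0`, depending only on `f`, such that for all `s₀` with `|s₀| ≤ 2r` and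
all `y ∈ B_r(0)`, the components of `y*(y)` differ from their first-order
Taylor expansions around `(s₀, f s₀)` by at most `C |y − (s₀, f s₀)|²`. -/
theorem lemma2_reflection_expansion
    (f : ℝ → ℝ) (hf : ContDiff ℝ 3 f) (hf0 : f 0 = 0) (hf'0 : deriv f 0 = 0)
    (r₀ : ℝ) (hr₀ : 0 < r₀) (S : EuclideanSpace ℝ (Fin 2) → ℝ)
    (hS : ∀ y ∈ Metric.ball (0 : EuclideanSpace ℝ (Fin 2)) r₀,
        S y ∈ Set.Ioo (-(2 * r₀)) (2 * r₀) ∧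
        (S y - y 0) + deriv f (S y) * (f (S y) - y 1) = 0 ∧
        ∀ s ∈ Set.Ioo (-(2 * r₀)) (2 * r₀),
          (s - y 0) + deriv f s * (f s - y 1) = 0 → s = S y)
    (hS2 : ContDiffOn ℝ 2 S (Metric.ball 0 r₀))
    (ystar : EuclideanSpace ℝ (Fin 2) → EuclideanSpace ℝ (Fin 2))
    (hystar : ∀ y, ystar y = (2 : ℝ) • pt (S y) (f (S y)) - y) :
    ∃ r C : ℝ, 0 < r ∧ r ≤ r₀ ∧ 0 < C ∧
      ∀ s₀ : ℝ, |s₀| ≤ 2 * r →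
        ∀ y ∈ Metric.ball (0 : EuclideanSpace ℝ (Fin 2)) r,
          |ystar y 0 - s₀
              - (1 - deriv f s₀ ^ 2) / (1 + deriv f s₀ ^ 2) * (y 0 - s₀)
              - 2 * deriv f s₀ / (1 + deriv f s₀ ^ 2) * (y 1 - f s₀)|
            ≤ C * ‖y - pt s₀ (f s₀)‖ ^ 2 ∧
          |ystar y 1 - f s₀
              - 2 * deriv f s₀ / (1 + deriv f s₀ ^ 2) * (y 0 - s₀)
              - (deriv f s₀ ^ 2 - 1) / (1 + deriv f s₀ ^ 2) * (y 1 - f s₀)|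
            ≤ C * ‖y - pt s₀ (f s₀)‖ ^ 2 := by
  obtain ⟨a, M, ha, hM, hb, hL⟩ :=
    exists_deriv_bound_and_lipschitz (hf.of_le (by norm_num)) hf'0
  have hdiff : Differentiable ℝ f := hf.differentiable (by norm_num)
  have hS0 : S 0 = 0 :=
    ((hS 0 (Metric.mem_ball_self hr₀)).2.2 0 (by constructor <;> linarith)
      (by simp [hf'0])).symm
  have hcont : ContinuousAt S 0 :=
    hS2.continuousOn.continuousAt (Metric.ball_mem_nhds 0 hr₀)
  have hSa : ∀ᶠ y in nhds (0 : EuclideanSpace ℝ (Fin 2)), |S y| < a :=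
    hcont.abs.eventually_lt continuousAt_const (by simpa [hS0] using ha)
  obtain ⟨ρ, hρ, hball⟩ := Metric.eventually_nhds_iff_ball.1 hSa
  refine ⟨min r₀ (min ρ (a / 2)), 14 * M + 1, by positivity, min_le_left _ _, by positivity,
    fun s₀ hs₀ y hy => ?_⟩
  have hyr : y ∈ Metric.ball (0 : EuclideanSpace ℝ (Fin 2)) r₀ :=
    Metric.ball_subset_ball (min_le_left _ _) hy
  have hs : S y ∈ Set.Icc (-a) a := abs_le.1
    (hball y (Metric.ball_subset_ball ((min_le_right _ _).trans (min_le_left _ _)) hy)).le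
  have hs₀' : s₀ ∈ Set.Icc (-a) a := by
    have h : min r₀ (min ρ (a / 2)) ≤ a / 2 := (min_le_right _ _).trans (min_le_right _ _)
    exact abs_le.1 (by linarith)
  have hFδ : |f (S y) - f s₀| ≤ 1 / 2 * |S y - s₀| :=
    (convex_Icc (-a) a).norm_image_sub_le_of_norm_deriv_le (fun x _ => hdiff x) hb hs₀' hs
  have hu : |y 0 - s₀| ≤ ‖y - pt s₀ (f s₀)‖ := by
    simpa [pt] using PiLp.norm_apply_le (y - pt s₀ (f s₀)) 0
  have hv : |y 1 - f s₀| ≤ ‖y - pt s₀ (f s₀)‖ := by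
    simpa [pt] using PiLp.norm_apply_le (y - pt s₀ (f s₀)) 1
  have h := reflection_expansion_scalar (δ := S y - s₀) (F := f (S y) - f s₀) hM
    (by linear_combination (hS y hyr).2.1) (hb s₀ hs₀') (hb _ hs) (hL _ hs _ hs₀') hFδ
    (abs_sub_sub_deriv_mul_le hdiff hM hL hs hs₀') hu hv
  have hy0 : ystar y 0 - s₀ = 2 * (S y - s₀) - (y 0 - s₀) := by
    simp [hystar, pt]
    ring
  have hy1 : ystar y 1 - f s₀ = 2 * (f (S y) - f s₀) - (y 1 - f s₀) := by
    simp [hystar, pt]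
    ring
  have hC : 14 * M * ‖y - pt s₀ (f s₀)‖ ^ 2 ≤ (14 * M + 1) * ‖y - pt s₀ (f s₀)‖ ^ 2 := by
    gcongr
    linarith
  rw [hy0, hy1]
  exact ⟨h.1.trans hC, h.2.trans hC⟩
end
end

section
/- There exists r > 0, depending only on f, such that the reflection map y ↦ y*(y) is injective on B_r(0). -/
open Real

noncomputable section

/-- A strictly differentiable function is approximated, at pairs of points of a small ball, by its
derivative. -/
theorem HasStrictFDerivAt.exists_ball_norm_sub_le {E F : Type*} [NormedAddCommGroup E]
    [NormedSpace ℝ E] [NormedAddCommGroup F] [NormedSpace ℝ F] {g : E → F} {g' : E →L[ℝ] F}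
    {x : E} (hg : HasStrictFDerivAt g g' x) {c : ℝ} (hc : 0 < c) :
    ∃ δ : ℝ, 0 < δ ∧ ∀ y ∈ Metric.ball x δ, ∀ z ∈ Metric.ball x δ,
      ‖g y - g z - g' (y - z)‖ ≤ c * ‖y - z‖ := by
  obtain ⟨δ, hδ, h⟩ := Metric.eventually_nhds_iff_ball.1 (hg.isLittleO.def hc)
  refine ⟨δ, hδ, fun y hy z hz => h (y, z) ?_⟩
  rw [← ball_prod_same]
  exact ⟨hy, hz⟩

/-- The foot-point map of the graph of a function vanishing to first order at `0` has the first
coordinate as its derivative at the origin. -/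
theorem fderiv_footpoint_eq_proj {f : ℝ → ℝ} (hf : ContDiff ℝ 3 f) (hf0 : f 0 = 0)
    (hf'0 : deriv f 0 = 0) {S : EuclideanSpace ℝ (Fin 2) → ℝ} (hS0 : S 0 = 0)
    (hS : DifferentiableAt ℝ S 0)
    (heq : ∀ᶠ y in nhds 0, (S y - y 0) + deriv f (S y) * (f (S y) - y 1) = 0) :
    fderiv ℝ S 0 = EuclideanSpace.proj (0 : Fin 2) := by
  have hp : ∀ i : Fin 2, HasFDerivAt (fun y : EuclideanSpace ℝ (Fin 2) => y i)
      (EuclideanSpace.proj i : EuclideanSpace ℝ (Fin 2) →L[ℝ] ℝ) 0 :=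
    fun i => (EuclideanSpace.proj i : EuclideanSpace ℝ (Fin 2) →L[ℝ] ℝ).hasFDerivAt
  have hd : Differentiable ℝ (deriv f) :=
    (hf.of_le (by norm_num : (2 : WithTop ℕ∞) ≤ 3)).differentiable_deriv_two
  have h1 : HasFDerivAt (fun y => deriv f (S y)) (deriv (deriv f) (S 0) • fderiv ℝ S 0) 0 :=
    (hd (S 0)).hasDerivAt.comp_hasFDerivAt 0 hS.hasFDerivAt
  have h2 : HasFDerivAt (fun y => f (S y)) (deriv f (S 0) • fderiv ℝ S 0) 0 :=
    ((hf.differentiable (by norm_num)) (S 0)).hasDerivAt.comp_hasFDerivAt 0 hS.hasFDerivAt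
  have h3 := (hS.hasFDerivAt.sub (hp 0)).add (h1.mul (h2.sub (hp 1)))
  have h4 : HasFDerivAt (fun _ : EuclideanSpace ℝ (Fin 2) => (0 : ℝ)) _ 0 :=
    h3.congr_of_eventuallyEq (by filter_upwards [heq] with y hy using hy.symm)
  have h5 := h4.unique (hasFDerivAt_const 0 0)
  simpa [hS0, hf0, hf'0, sub_eq_zero] using h5

/-- **Lemma 2 (injectivity of the reflection).**
With `f`, the implicit map `S` of Lemma 1 (defined on a ball of radius `r₀`),
`e(y) = (S y, f (S y))` and `y*(y) = 2 e(y) − y`: there exists `r > 0`,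
depending only on `f`, such that `y ↦ y*(y)` is injective on `B_r(0)`. -/
theorem reflection_injective_near_origin
    (f : ℝ → ℝ) (hf : ContDiff ℝ 3 f) (hf0 : f 0 = 0) (hf'0 : deriv f 0 = 0)
    (r₀ : ℝ) (hr₀ : 0 < r₀) (S : EuclideanSpace ℝ (Fin 2) → ℝ)
    (hS : ∀ y ∈ Metric.ball (0 : EuclideanSpace ℝ (Fin 2)) r₀,
        S y ∈ Set.Ioo (-(2 * r₀)) (2 * r₀) ∧
        (S y - y 0) + deriv f (S y) * (f (S y) - y 1) = 0 ∧
        ∀ s ∈ Set.Ioo (-(2 * r₀)) (2 * r₀),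
          (s - y 0) + deriv f s * (f s - y 1) = 0 → s = S y)
    (hS2 : ContDiffOn ℝ 2 S (Metric.ball 0 r₀))
    (ystar : EuclideanSpace ℝ (Fin 2) → EuclideanSpace ℝ (Fin 2))
    (hystar : ∀ y, ystar y = (2 : ℝ) • pt (S y) (f (S y)) - y) :
    ∃ r : ℝ, 0 < r ∧ r ≤ r₀ ∧
      Set.InjOn ystar (Metric.ball (0 : EuclideanSpace ℝ (Fin 2)) r) := by
  have hB : Metric.ball (0 : EuclideanSpace ℝ (Fin 2)) r₀ ∈ nhds 0 := Metric.ball_mem_nhds 0 hr₀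
  have hS0 : S 0 = 0 :=
    ((hS 0 (Metric.mem_ball_self hr₀)).2.2 0 ⟨by linarith, by linarith⟩ (by simp [hf0])).symm
  have hSs : HasStrictFDerivAt S (fderiv ℝ S 0) 0 :=
    (hS2.contDiffAt hB).hasStrictFDerivAt (by norm_num)
  have hfS : HasStrictFDerivAt (fun y => f (S y)) (deriv f (S 0) • fderiv ℝ S 0) 0 :=
    (hf.contDiffAt.hasStrictDerivAt (by norm_num)).comp_hasStrictFDerivAt 0 hSs
  rw [fderiv_footpoint_eq_proj hf hf0 hf'0 hS0 hSs.differentiableAt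
    (by filter_upwards [hB] with y hy using (hS y hy).2.1)] at hSs hfS
  rw [hS0, hf'0, zero_smul] at hfS
  obtain ⟨a, ha, hSa⟩ := hSs.exists_ball_norm_sub_le (c := 1 / 8) (by norm_num)
  obtain ⟨b, hb, hfb⟩ := hfS.exists_ball_norm_sub_le (c := 1 / 8) (by norm_num)
  refine ⟨min r₀ (min a b), by positivity, min_le_left _ _, fun y hy z hz h => ?_⟩
  have hra : min r₀ (min a b) ≤ a := (min_le_right _ _).trans (min_le_left _ _)
  have hrb : min r₀ (min a b) ≤ b := (min_le_right _ _).trans (min_le_right _ _)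
  have h1 := hSa y (Metric.ball_subset_ball hra hy) z (Metric.ball_subset_ball hra hz)
  have h2 := hfb y (Metric.ball_subset_ball hrb hy) z (Metric.ball_subset_ball hrb hz)
  rw [hystar, hystar] at h
  have e0 : 2 * S y - y 0 = 2 * S z - z 0 := by
    simpa [pt] using congrArg (fun v : EuclideanSpace ℝ (Fin 2) => v 0) h
  have e1 : 2 * f (S y) - y 1 = 2 * f (S z) - z 1 := by
    simpa [pt] using congrArg (fun v : EuclideanSpace ℝ (Fin 2) => v 1) h
  simp only [PiLp.proj_apply, PiLp.sub_apply, zero_apply, sub_zero,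
    Real.norm_eq_abs, abs_le] at h1 h2
  have hn : ‖y - z‖ ^ 2 = (y 0 - z 0) ^ 2 + (y 1 - z 1) ^ 2 := by
    simp [EuclideanSpace.norm_sq_eq]
  have b0 : (y 0 - z 0) ^ 2 ≤ (‖y - z‖ / 4) ^ 2 :=
    sq_le_sq' (by linarith) (by linarith)
  have b1 : (y 1 - z 1) ^ 2 ≤ (‖y - z‖ / 4) ^ 2 :=
    sq_le_sq' (by linarith) (by linarith)
  have hz0 : ‖y - z‖ = 0 := by
    have : ‖y - z‖ ^ 2 = 0 := le_antisymm (by linarith) (sq_nonneg _)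
    exact pow_eq_zero_iff two_ne_zero |>.1 this
  exact sub_eq_zero.1 (norm_eq_zero.1 hz0)
end
end

section
/- There exists r > 0 such that for every y ∈ B_r(0) ∩ Ω, the reflected point y*(y) does not belong to Ω. -/
open Real

noncomputable section

lemma exists_lipschitz_half_of_deriv_eq_zero {f : ℝ → ℝ} (hf : ContDiff ℝ 1 f)
    (hf'0 : deriv f 0 = 0) :
    ∃ δ > 0, (∀ x ∈ Metric.ball (0 : ℝ) δ, |deriv f x| ≤ 1 / 2) ∧
      ∀ x ∈ Metric.ball (0 : ℝ) δ, ∀ y ∈ Metric.ball (0 : ℝ) δ,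
        |f y - f x| ≤ 1 / 2 * |y - x| := by
  have hc : ContinuousAt (fun x => |deriv f x|) 0 :=
    (hf.continuous_deriv le_rfl).abs.continuousAt
  have hev : ∀ᶠ x in nhds (0 : ℝ), |deriv f x| < 1 / 2 :=
    hc.eventually_lt continuousAt_const (by simp [hf'0])
  obtain ⟨δ, hδ, h⟩ := Metric.eventually_nhds_iff_ball.1 hev
  refine ⟨δ, hδ, fun x hx => (h x hx).le, fun x hx y hy => ?_⟩
  exact (convex_ball (0 : ℝ) δ).norm_image_sub_le_of_norm_deriv_le
    (fun z _ => (hf.differentiable one_ne_zero) z) (fun z hz => (h z hz).le) hx hy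

/-- Two points on a normal line of slope-direction `(-m, 1)`, symmetric about a point of the graph
of `f`, are not both strictly above the graph. -/
lemma not_both_above_graph {f : ℝ → ℝ} {s m d : ℝ} (hm : |m| ≤ 1 / 2)
    (h₁ : |f (s - m * d) - f s| ≤ 1 / 2 * |s - m * d - s|)
    (h₂ : |f (s + m * d) - f s| ≤ 1 / 2 * |s + m * d - s|)
    (ha : f (s - m * d) < f s + d) : ¬ f (s + m * d) < f s - d := by
  intro hb
  have hmd : |m * d| ≤ 1 / 2 * |d| := by
    rw [abs_mul]
    gcongr
  rw [show s - m * d - s = -(m * d) by ring, abs_neg] at h₁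
  rw [show s + m * d - s = m * d by ring] at h₂
  have h₁' := neg_abs_le (f (s - m * d) - f s)
  have h₂' := neg_abs_le (f (s + m * d) - f s)
  rcases abs_cases d with ⟨h, _⟩ | ⟨h, _⟩ <;> linarith

/-- **Lemma 3 (the reflected point lies outside the domain).**
`Ω ⊆ ℝ²` is open and near the origin coincides with the open region strictly
above the graph of `f` (i.e. `Ω ∩ B_ρ(0) = {x ∈ B_ρ(0) : x₂ > f x₁}`).  With
the implicit map `S` of Lemma 1 and the reflection `y*(y) = 2 (S y, f (S y)) − y`:
there exists `r > 0` such that for every `y ∈ B_r(0) ∩ Ω`, `y*(y) ∉ Ω`. -/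
theorem reflection_outside_domain
    (f : ℝ → ℝ) (hf : ContDiff ℝ 3 f) (hf0 : f 0 = 0) (hf'0 : deriv f 0 = 0)
    (Ω : Set (EuclideanSpace ℝ (Fin 2))) (hΩo : IsOpen Ω)
    (ρ : ℝ) (hρ : 0 < ρ)
    (hgraph : Ω ∩ Metric.ball (0 : EuclideanSpace ℝ (Fin 2)) ρ
        = {x ∈ Metric.ball (0 : EuclideanSpace ℝ (Fin 2)) ρ | f (x 0) < x 1})
    (r₀ : ℝ) (hr₀ : 0 < r₀) (S : EuclideanSpace ℝ (Fin 2) → ℝ)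
    (hS : ∀ y ∈ Metric.ball (0 : EuclideanSpace ℝ (Fin 2)) r₀,
        S y ∈ Set.Ioo (-(2 * r₀)) (2 * r₀) ∧
        (S y - y 0) + deriv f (S y) * (f (S y) - y 1) = 0 ∧
        ∀ s ∈ Set.Ioo (-(2 * r₀)) (2 * r₀),
          (s - y 0) + deriv f s * (f s - y 1) = 0 → s = S y)
    (hS2 : ContDiffOn ℝ 2 S (Metric.ball 0 r₀))
    (ystar : EuclideanSpace ℝ (Fin 2) → EuclideanSpace ℝ (Fin 2))
    (hystar : ∀ y, ystar y = (2 : ℝ) • pt (S y) (f (S y)) - y) :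
    ∃ r : ℝ, 0 < r ∧ r ≤ r₀ ∧
      ∀ y ∈ Metric.ball (0 : EuclideanSpace ℝ (Fin 2)) r ∩ Ω, ystar y ∉ Ω := by
  have hf1 : ContDiff ℝ 1 f := hf.of_le (by norm_num)
  obtain ⟨δ, hδ, hderiv, hlip⟩ := exists_lipschitz_half_of_deriv_eq_zero hf1 hf'0
  have hS0 : S 0 = 0 :=
    ((hS 0 (Metric.mem_ball_self hr₀)).2.2 0 (by constructor <;> linarith) (by simp [hf'0])).symm
  have hSc : ContinuousAt S 0 :=
    hS2.continuousOn.continuousAt (Metric.ball_mem_nhds 0 hr₀)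
  have hSmem : ∀ᶠ y in nhds 0, S y ∈ Metric.ball (0 : ℝ) δ :=
    hSc.eventually_mem (by rw [hS0]; exact Metric.ball_mem_nhds 0 hδ)
  have hpt : Continuous fun t : ℝ => pt t (f t) := by
    have := hf.continuous
    unfold pt
    simp only [WithLp.equiv_symm_apply]
    fun_prop
  have hystar0 : ystar 0 = 0 := by
    rw [hystar, hS0, hf0]
    ext i
    fin_cases i <;> simp [pt]
  have hstarc : ContinuousAt ystar 0 := by
    rw [funext hystar]
    have hcomp : ContinuousAt (fun y => pt (S y) (f (S y))) 0 :=
      hpt.continuousAt.comp (f := S) hSc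
    exact (hcomp.const_smul (2 : ℝ)).sub continuousAt_id
  have hstar : ∀ᶠ y in nhds 0,
      ystar y ∈ Metric.ball (0 : EuclideanSpace ℝ (Fin 2)) (min ρ δ) :=
    hstarc.eventually_mem (by rw [hystar0]; exact Metric.ball_mem_nhds 0 (lt_min hρ hδ))
  have hy : ∀ᶠ y in nhds 0, y ∈ Metric.ball (0 : EuclideanSpace ℝ (Fin 2)) (min ρ δ) :=
    Metric.ball_mem_nhds 0 (lt_min hρ hδ)
  obtain ⟨ε, hε, h⟩ := Metric.eventually_nhds_iff_ball.1 (hSmem.and (hstar.and hy))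
  have above : ∀ x ∈ Metric.ball (0 : EuclideanSpace ℝ (Fin 2)) (min ρ δ), x ∈ Ω →
      f (x 0) < x 1 ∧ x 0 ∈ Metric.ball (0 : ℝ) δ := by
    intro x hx hxΩ
    rw [mem_ball_zero_iff] at hx
    have hxρ : x ∈ Metric.ball (0 : EuclideanSpace ℝ (Fin 2)) ρ :=
      mem_ball_zero_iff.2 (hx.trans_le (min_le_left _ _))
    refine ⟨(hgraph.subset ⟨hxΩ, hxρ⟩).2, mem_ball_zero_iff.2 ?_⟩
    exact (PiLp.norm_apply_le x 0).trans_lt (hx.trans_le (min_le_right _ _))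
  refine ⟨min ε r₀, lt_min hε hr₀, min_le_right _ _, ?_⟩
  rintro y ⟨hyr, hyΩ⟩ hyΩ'
  obtain ⟨hs, hys, hyb⟩ := h y (Metric.ball_subset_ball (min_le_left _ _) hyr)
  have heq := (hS y (Metric.ball_subset_ball (min_le_right _ _) hyr)).2.1
  obtain ⟨ha, ha'⟩ := above y hyb hyΩ
  obtain ⟨hb, hb'⟩ := above _ hys hyΩ'
  have h0 : ystar y 0 = 2 * S y - y 0 := by simp [hystar, pt]
  have h1 : ystar y 1 = 2 * f (S y) - y 1 := by simp [hystar, pt]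
  have ea : y 0 = S y - deriv f (S y) * (y 1 - f (S y)) := by linarith
  have eb : ystar y 0 = S y + deriv f (S y) * (y 1 - f (S y)) := by linarith
  have la := hlip _ hs _ ha'
  have lb := hlip _ hs _ hb'
  rw [ea] at ha la
  rw [eb] at hb lb
  exact not_both_above_graph (hderiv _ hs) la lb (by linarith) (by linarith)
end
end

section
/- There exist r > 0 and C > 0, depending only on f, such that for all s with |s| ≤ r and all y ∈ B_r(0) with y₂ > f(y₁) and y ≠ (s, f(s))), writing x = (s, f(s)), the second derivative in s of the function s ↦ log|(s, f(s)) − y| − log|(s, f(s)) − y*(y)| is bounded in absolute value by C/|x − y|. -/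
open Real

noncomputable section

open Filter Topology

/-- The logarithm of the distance to `pt a b`, in coordinates. -/
theorem log_norm_pt_sub (a b : ℝ) (z : EuclideanSpace ℝ (Fin 2)) :
    Real.log ‖pt a b - z‖ = 1 / 2 * Real.log ((a - z 0) ^ 2 + (b - z 1) ^ 2) := by
  rw [EuclideanSpace.norm_eq, Real.log_sqrt (by positivity)]
  simp [pt, Fin.sum_univ_two]
  ring

/-- The squared distance to `pt a b`, in coordinates. -/
theorem norm_pt_sub_sq (a b : ℝ) (z : EuclideanSpace ℝ (Fin 2)) :
    ‖pt a b - z‖ ^ 2 = (a - z 0) ^ 2 + (b - z 1) ^ 2 := by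
  rw [EuclideanSpace.norm_sq_eq]
  simp [pt, Fin.sum_univ_two]

/-- Second derivative of half the difference of two logarithms. -/
theorem iteratedDeriv_two_half_log_sub_log {P Q P' Q' : ℝ → ℝ} {P'' Q'' s : ℝ}
    (hP : ∀ t, HasDerivAt P (P' t) t) (hQ : ∀ t, HasDerivAt Q (Q' t) t)
    (hP' : HasDerivAt P' P'' s) (hQ' : HasDerivAt Q' Q'' s) (hPs : 0 < P s) (hQs : 0 < Q s) :
    iteratedDeriv 2 (fun t => 1 / 2 * Real.log (P t) - 1 / 2 * Real.log (Q t)) s =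
      1 / 2 * ((P'' * P s - P' s * P' s) / P s ^ 2)
        - 1 / 2 * ((Q'' * Q s - Q' s * Q' s) / Q s ^ 2) := by
  rw [iteratedDeriv_succ, iteratedDeriv_one]
  have hev : deriv (fun t => 1 / 2 * Real.log (P t) - 1 / 2 * Real.log (Q t)) =ᶠ[𝓝 s]
      fun t => 1 / 2 * (P' t / P t) - 1 / 2 * (Q' t / Q t) := by
    filter_upwards [(hP s).continuousAt.eventually (lt_mem_nhds hPs),
      (hQ s).continuousAt.eventually (lt_mem_nhds hQs)] with t htP htQ
    exact ((((hP t).log htP.ne').const_mul _).sub (((hQ t).log htQ.ne').const_mul _)).deriv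
  rw [hev.deriv_eq]
  exact (((hP'.div (hP s) hPs.ne').const_mul _).sub
    ((hQ'.div (hQ s) hQs.ne').const_mul _)).deriv

/-- The algebraic estimate: for `P = A - 2 l h` and `Q = A + 2 l h`, the second derivative of
`(log P - log Q) / 2` is `O(|l| / A)`. -/
theorem abs_half_log_sub_log_second_deriv_le {A A' A'' l h h' h'' u L : ℝ} (hL : 1 ≤ L)
    (hA : 0 < A) (hu : u ^ 2 ≤ A) (hlL : |l| * L ≤ 1 / 4)
    (hh : |h| ≤ L * u ^ 2) (hh' : |h'| ≤ L * |u|) (hh'' : |h''| ≤ L)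
    (hA' : |A'| ≤ L * |u|) (hA'' : |A''| ≤ L) :
    |1 / 2 * (((A'' - 2 * l * h'') * (A - 2 * l * h) - (A' - 2 * l * h') * (A' - 2 * l * h'))
          / (A - 2 * l * h) ^ 2)
        - 1 / 2 * (((A'' + 2 * l * h'') * (A + 2 * l * h)
          - (A' + 2 * l * h') * (A' + 2 * l * h')) / (A + 2 * l * h) ^ 2)|
      ≤ 208 * L ^ 3 * (|l| / A) := by
  have hL0 : 0 < L := by linarith
  have hlh : |l * h| ≤ A / 4 := by
    rw [abs_mul]
    calc |l| * |h| ≤ |l| * (L * u ^ 2) := by gcongr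
      _ = |l| * L * u ^ 2 := by ring
      _ ≤ 1 / 4 * A := by gcongr
      _ = A / 4 := by ring
  have hlh' : |l * h'| ≤ |u| / 4 := by
    rw [abs_mul]
    calc |l| * |h'| ≤ |l| * (L * |u|) := by gcongr
      _ = |l| * L * |u| := by ring
      _ ≤ 1 / 4 * |u| := by gcongr
      _ = |u| / 4 := by ring
  obtain ⟨hlh1, hlh2⟩ := abs_le.1 hlh
  have hP : A / 2 ≤ A - 2 * l * h := by linarith
  have hQ : A / 2 ≤ A + 2 * l * h := by linarith
  have hP0 : 0 < A - 2 * l * h := by linarith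
  have hQ0 : 0 < A + 2 * l * h := by linarith
  have hPQ : A ^ 2 / 4 ≤ (A - 2 * l * h) * (A + 2 * l * h) := by
    calc A ^ 2 / 4 = A / 2 * (A / 2) := by ring
      _ ≤ _ := by gcongr
  have hPQ2 : A ^ 4 / 16 ≤ ((A - 2 * l * h) * (A + 2 * l * h)) ^ 2 := by
    calc A ^ 4 / 16 = (A ^ 2 / 4) ^ 2 := by ring
      _ ≤ _ := by gcongr
  set D := (A - 2 * l * h) * (A + 2 * l * h) with hD
  have hD0 : 0 < D := mul_pos hP0 hQ0
  have key : 1 / 2 * (((A'' - 2 * l * h'') * (A - 2 * l * h)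
          - (A' - 2 * l * h') * (A' - 2 * l * h')) / (A - 2 * l * h) ^ 2)
        - 1 / 2 * (((A'' + 2 * l * h'') * (A + 2 * l * h)
          - (A' + 2 * l * h') * (A' + 2 * l * h')) / (A + 2 * l * h) ^ 2)
      = 1 / 2 * ((4 * l * (h * A'' - h'' * A)) / D)
        - 1 / 2 * ((4 * l * (h * A' - h' * A)) * (2 * A * A' - 8 * (l * h) * (l * h')) / D ^ 2) := by
    have h1 := hP0.ne'
    have h2 := hQ0.ne'
    rw [hD]
    field_simp
    ring
  have n1 : |4 * l * (h * A'' - h'' * A)| ≤ 8 * |l| * L ^ 2 * A := by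
    have : |h * A'' - h'' * A| ≤ 2 * L ^ 2 * A := by
      calc |h * A'' - h'' * A| ≤ |h| * |A''| + |h''| * A := by
            refine (abs_sub _ _).trans ?_
            rw [abs_mul, abs_mul, abs_of_pos hA]
        _ ≤ L * u ^ 2 * L + L * A := by gcongr
        _ ≤ L * A * L + L * A * L := by
            have := mul_le_mul_of_nonneg_left hL (mul_pos hL0 hA).le
            have := mul_le_mul_of_nonneg_left hu (mul_pos hL0 hL0).le
            nlinarith
        _ = _ := by ring
    rw [abs_mul, abs_mul, abs_of_pos (by norm_num : (0 : ℝ) < 4)]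
    calc 4 * |l| * |h * A'' - h'' * A| ≤ 4 * |l| * (2 * L ^ 2 * A) := by gcongr
      _ = _ := by ring
  have n2 : |4 * l * (h * A' - h' * A)| ≤ 8 * |l| * L ^ 2 * A * |u| := by
    have : |h * A' - h' * A| ≤ 2 * L ^ 2 * A * |u| := by
      calc |h * A' - h' * A| ≤ |h| * |A'| + |h'| * A := by
            refine (abs_sub _ _).trans ?_
            rw [abs_mul, abs_mul, abs_of_pos hA]
        _ ≤ L * u ^ 2 * (L * |u|) + L * |u| * A := by gcongr
        _ ≤ L * A * (L * |u|) + L * |u| * A * L := by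
            have h0 : 0 ≤ L * |u| := by positivity
            have := mul_le_mul_of_nonneg_left hL (mul_nonneg h0 hA.le)
            have := mul_le_mul_of_nonneg_left hu (mul_nonneg hL0.le h0)
            nlinarith
        _ = _ := by ring
    rw [abs_mul, abs_mul, abs_of_pos (by norm_num : (0 : ℝ) < 4)]
    calc 4 * |l| * |h * A' - h' * A| ≤ 4 * |l| * (2 * L ^ 2 * A * |u|) := by gcongr
      _ = _ := by ring
  have n3 : |2 * A * A' - 8 * (l * h) * (l * h')| ≤ 3 * L * A * |u| := by
    calc |2 * A * A' - 8 * (l * h) * (l * h')|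
        ≤ 2 * A * |A'| + 8 * |l * h| * |l * h'| := by
          refine (abs_sub _ _).trans (le_of_eq ?_)
          simp only [abs_mul, abs_of_pos hA]
          norm_num
      _ ≤ 2 * A * (L * |u|) + 8 * (A / 4) * (|u| / 4) := by gcongr
      _ ≤ _ := by nlinarith [mul_nonneg hA.le (abs_nonneg u)]
  have b1 : |4 * l * (h * A'' - h'' * A) / D| ≤ 32 * L ^ 2 * (|l| / A) := by
    rw [abs_div, abs_of_pos hD0]
    calc _ ≤ 8 * |l| * L ^ 2 * A / (A ^ 2 / 4) := by gcongr
      _ = _ := by field_simp; ring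
  have b2 : |(4 * l * (h * A' - h' * A)) * (2 * A * A' - 8 * (l * h) * (l * h')) / D ^ 2|
      ≤ 384 * L ^ 3 * (|l| / A) := by
    rw [abs_div, abs_mul _ (2 * A * A' - 8 * (l * h) * (l * h')), abs_of_pos (pow_pos hD0 2)]
    calc _ ≤ 8 * |l| * L ^ 2 * A * |u| * (3 * L * A * |u|) / (A ^ 4 / 16) := by gcongr
      _ = 384 * |l| * L ^ 3 * u ^ 2 / A ^ 2 := by
        rw [← sq_abs u]; field_simp; ring
      _ ≤ 384 * |l| * L ^ 3 * A / A ^ 2 := by gcongr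
      _ = _ := by field_simp
  rw [key]
  have hLL : L ^ 2 * (|l| / A) ≤ L ^ 3 * (|l| / A) := by
    gcongr ?_ * _
    exact pow_le_pow_right₀ hL (by norm_num)
  obtain ⟨b1l, b1r⟩ := abs_le.1 b1
  obtain ⟨b2l, b2r⟩ := abs_le.1 b2
  rw [abs_le]
  constructor <;> linarith

/-- Increments of a function whose derivative is bounded between the two points. -/
theorem abs_sub_le_of_hasDerivAt_of_abs_le {g g' : ℝ → ℝ} {a b B : ℝ}
    (hg : ∀ t, HasDerivAt g (g' t) t) (hB : ∀ t ∈ Set.uIcc a b, |g' t| ≤ B) :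
    |g b - g a| ≤ B * |b - a| :=
  (convex_uIcc a b).norm_image_sub_le_of_norm_hasDerivWithin_le
    (fun t _ => (hg t).hasDerivWithinAt) hB Set.left_mem_uIcc Set.right_mem_uIcc

/-- The kernel bound for a fixed foot point `p`: the point is `(p, f p) + l (-f' p, 1)`. -/
theorem abs_iteratedDeriv_two_log_reflection_le {f f' f'' : ℝ → ℝ} {M K p l s : ℝ}
    (hf : ∀ t, HasDerivAt f (f' t) t) (hf' : ∀ t, HasDerivAt f' (f'' t) t)
    (hK : 1 ≤ K) (hMK : 2 * M ≤ K)
    (hb : ∀ t ∈ Set.Icc (-M) M, |f' t| ≤ K ∧ |f'' t| ≤ K)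
    (hp : p ∈ Set.Icc (-M) M) (hs : s ∈ Set.Icc (-M) M) (hl : |l| * (6 * K ^ 3) ≤ 1 / 4)
    (hpos : 0 < (s - (p - l * f' p)) ^ 2 + (f s - (f p + l)) ^ 2) :
    |iteratedDeriv 2 (fun t =>
        1 / 2 * Real.log ((t - (p - l * f' p)) ^ 2 + (f t - (f p + l)) ^ 2)
        - 1 / 2 * Real.log ((t - (p + l * f' p)) ^ 2 + (f t - (f p - l)) ^ 2)) s|
      ≤ 416 * (6 * K ^ 3) ^ 3 /
        √((s - (p - l * f' p)) ^ 2 + (f s - (f p + l)) ^ 2) := by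
  have hsub : Set.uIcc p s ⊆ Set.Icc (-M) M :=
    Set.OrdConnected.uIcc_subset Set.ordConnected_Icc hp hs
  have hd : |f s - f p| ≤ K * |s - p| :=
    abs_sub_le_of_hasDerivAt_of_abs_le hf fun t ht => (hb t (hsub ht)).1
  have hd' : ∀ t ∈ Set.uIcc p s, |f' t - f' p| ≤ K * |s - p| := fun t ht =>
    (abs_sub_le_of_hasDerivAt_of_abs_le hf' fun v hv =>
      (hb v (hsub (Set.uIcc_subset_uIcc_left ht hv))).2).trans
      (mul_le_mul_of_nonneg_left (Set.abs_sub_left_of_mem_uIcc ht) (by linarith))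
  have hh : |(f s - f p) - f' p * (s - p)| ≤ K * |s - p| * |s - p| := by
    have := abs_sub_le_of_hasDerivAt_of_abs_le
      (g := fun t => f t - f' p * t) (g' := fun t => f' t - f' p) (a := p) (b := s)
      (fun t => ((hf t).sub ((hasDerivAt_id t).const_mul (f' p))).congr_deriv (by simp)) hd'
    convert this using 2
    ring
  obtain ⟨hfs, hffs⟩ := hb s hs
  have hu : |s - p| ≤ K := by
    rw [abs_le]; constructor <;> linarith [hp.1, hp.2, hs.1, hs.2]
  have hK1 : K ≤ 6 * K ^ 3 := by
    nlinarith [pow_pos (by linarith : 0 < K) 2, pow_pos (by linarith : 0 < K) 3,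
      one_le_pow₀ (n := 2) hK]
  have hK2 : 1 + K ^ 2 ≤ 2 * K ^ 3 := by
    nlinarith [one_le_pow₀ (n := 2) hK, one_le_pow₀ (n := 3) hK]
  set A : ℝ → ℝ := fun t => (t - p) ^ 2 + (f t - f p) ^ 2 + l ^ 2 * (1 + f' p ^ 2) with hAdef
  set A' : ℝ → ℝ := fun t => 2 * (t - p) + 2 * (f t - f p) * f' t with hA'def
  set h : ℝ → ℝ := fun t => f t - f p - f' p * (t - p) with hhdef
  set A'' : ℝ := 2 + (2 * f' s * f' s + 2 * (f s - f p) * f'' s) with hA''def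
  have eP : ∀ t, (t - (p - l * f' p)) ^ 2 + (f t - (f p + l)) ^ 2 = A t - 2 * l * h t := by
    intro t; simp only [hAdef, hhdef]; ring
  have eQ : ∀ t, (t - (p + l * f' p)) ^ 2 + (f t - (f p - l)) ^ 2 = A t + 2 * l * h t := by
    intro t; simp only [hAdef, hhdef]; ring
  have dA : ∀ t, HasDerivAt A (A' t) t := fun t =>
    (((((hasDerivAt_id t).sub_const p).pow 2).add (((hf t).sub_const (f p)).pow 2)).add_const
      (l ^ 2 * (1 + f' p ^ 2))).congr_deriv (by simp [hA'def])
  have dh : ∀ t, HasDerivAt h (f' t - f' p) t := fun t =>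
    (((hf t).sub_const (f p)).sub
      (((hasDerivAt_id t).sub_const p).const_mul (f' p))).congr_deriv (by simp)
  have dA' : HasDerivAt A' A'' s :=
    ((((hasDerivAt_id s).sub_const p).const_mul 2).add
      ((((hf s).sub_const (f p)).const_mul 2).mul (hf' s))).congr_deriv (by simp [hA''def])
  have dh' : HasDerivAt (fun t => f' t - f' p) (f'' s) s := (hf' s).sub_const _
  have hA2 : (s - p) ^ 2 ≤ A s := by
    simp only [hAdef]
    nlinarith [sq_nonneg (f s - f p),
      mul_nonneg (sq_nonneg l) (sq_nonneg (f' p)), sq_nonneg l]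
  have hAl : l ^ 2 ≤ A s := by
    simp only [hAdef]
    nlinarith [sq_nonneg (f s - f p),
      mul_nonneg (sq_nonneg l) (sq_nonneg (f' p)), sq_nonneg (s - p)]
  set L := 6 * K ^ 3 with hLdef
  have hL : 1 ≤ L := hK.trans hK1
  have bh : |h s| ≤ L * (s - p) ^ 2 := by
    rw [← sq_abs (s - p)]
    calc |h s| ≤ K * |s - p| * |s - p| := hh
      _ = K * |s - p| ^ 2 := by ring
      _ ≤ _ := by gcongr
  have blh : |l * h s| ≤ A s / 4 := by
    rw [abs_mul]
    calc |l| * |h s| ≤ |l| * (L * (s - p) ^ 2) := by gcongr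
      _ = |l| * L * (s - p) ^ 2 := by ring
      _ ≤ 1 / 4 * A s := by gcongr
      _ = A s / 4 := by ring
  obtain ⟨blh1, blh2⟩ := abs_le.1 blh
  simp only [eP, eQ] at hpos ⊢
  have hA0 : 0 < A s := by linarith
  rw [iteratedDeriv_two_half_log_sub_log (P := fun t => A t - 2 * l * h t)
    (Q := fun t => A t + 2 * l * h t) (P' := fun t => A' t - 2 * l * (f' t - f' p))
    (Q' := fun t => A' t + 2 * l * (f' t - f' p)) (fun t => (dA t).sub ((dh t).const_mul _))
    (fun t => (dA t).add ((dh t).const_mul _)) (dA'.sub (dh'.const_mul _))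
    (dA'.add (dh'.const_mul _)) hpos (by linarith)]
  refine (abs_half_log_sub_log_second_deriv_le hL hA0 hA2 hl bh
    ((hd' s Set.right_mem_uIcc).trans (by gcongr)) (hffs.trans hK1) ?_ ?_).trans ?_
  · calc |A' s| ≤ 2 * |s - p| + 2 * |f s - f p| * |f' s| := by
          refine (abs_add_le _ _).trans (le_of_eq ?_)
          simp [abs_mul]
      _ ≤ 2 * |s - p| + 2 * (K * |s - p|) * K := by gcongr
      _ = 2 * (1 + K ^ 2) * |s - p| := by ring
      _ ≤ L * |s - p| := by gcongr; nlinarith [pow_pos (by linarith : 0 < K) 3]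
  · calc |A''| ≤ 2 + (2 * |f' s| * |f' s| + 2 * |f s - f p| * |f'' s|) := by
          refine (abs_add_le _ _).trans <|
            add_le_add (by norm_num) <| (abs_add_le _ _).trans <| le_of_eq ?_
          simp [abs_mul]
      _ ≤ 2 + (2 * K * K + 2 * (K * K) * K) := by
          gcongr
          exact hd.trans (by gcongr)
      _ ≤ L := by nlinarith
  · have hPpos : 0 < √(A s - 2 * l * h s) := Real.sqrt_pos.2 hpos
    have hsq : |l| * √(A s - 2 * l * h s) ≤ 2 * A s := by
      refine abs_le_of_sq_le_sq' ?_ (by linarith) |>.2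
      rw [mul_pow, sq_abs, Real.sq_sqrt hpos.le]
      nlinarith [mul_le_mul hAl (by linarith : A s - 2 * l * h s ≤ 4 * A s) hpos.le hA0.le]
    rw [le_div_iff₀ hPpos]
    calc 208 * L ^ 3 * (|l| / A s) * √(A s - 2 * l * h s)
        = 208 * L ^ 3 * (|l| * √(A s - 2 * l * h s) / A s) := by ring
      _ ≤ 208 * L ^ 3 * (2 * A s / A s) := by gcongr
      _ = 416 * L ^ 3 := by field_simp; norm_num

/-- **Second-derivative bound for the boundary kernel.**
With `f`, the implicit map `S` of Lemma 1 (on a ball of radius `r₀`) and the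
reflection `y*(y) = 2 (S y, f (S y)) − y`: there exist `r > 0` and `C > 0`,
depending only on `f`, such that for all `s` with `|s| ≤ r` and all
`y ∈ B_r(0)` with `y₂ > f y₁` and `y ≠ (s, f s)`, writing `x = (s, f s)`,
the second derivative in `s` of
`s ↦ log |(s, f s) − y| − log |(s, f s) − y*(y)|`
is bounded in absolute value by `C / |x − y|`. -/
theorem boundary_kernel_second_derivative_bound
    (f : ℝ → ℝ) (hf : ContDiff ℝ 3 f) (hf0 : f 0 = 0) (hf'0 : deriv f 0 = 0)
    (r₀ : ℝ) (hr₀ : 0 < r₀) (S : EuclideanSpace ℝ (Fin 2) → ℝ)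
    (hS : ∀ y ∈ Metric.ball (0 : EuclideanSpace ℝ (Fin 2)) r₀,
        S y ∈ Set.Ioo (-(2 * r₀)) (2 * r₀) ∧
        (S y - y 0) + deriv f (S y) * (f (S y) - y 1) = 0 ∧
        ∀ s ∈ Set.Ioo (-(2 * r₀)) (2 * r₀),
          (s - y 0) + deriv f s * (f s - y 1) = 0 → s = S y)
    (hS2 : ContDiffOn ℝ 2 S (Metric.ball 0 r₀))
    (ystar : EuclideanSpace ℝ (Fin 2) → EuclideanSpace ℝ (Fin 2))
    (hystar : ∀ y, ystar y = (2 : ℝ) • pt (S y) (f (S y)) - y) :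
    ∃ r C : ℝ, 0 < r ∧ r ≤ r₀ ∧ 0 < C ∧
      ∀ s : ℝ, |s| ≤ r →
        ∀ y ∈ Metric.ball (0 : EuclideanSpace ℝ (Fin 2)) r,
          f (y 0) < y 1 → y ≠ pt s (f s) →
          |iteratedDeriv 2
              (fun t => Real.log ‖pt t (f t) - y‖ - Real.log ‖pt t (f t) - ystar y‖) s|
            ≤ C / ‖pt s (f s) - y‖ := by
  have hdf : Differentiable ℝ f := hf.differentiable (by norm_num)
  have hf1 : ContDiff ℝ 2 (deriv f) := (contDiff_succ_iff_deriv.1 (show ContDiff ℝ (2 + 1) f by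
    norm_num; exact hf)).2.2
  have hdf1 : Differentiable ℝ (deriv f) := hf1.differentiable (by norm_num)
  have hcf2 : Continuous (deriv (deriv f)) := hf1.continuous_deriv (by norm_num)
  obtain ⟨K₁, hK₁⟩ := isCompact_Icc.exists_bound_of_continuousOn
    (s := Set.Icc (-(2 * r₀)) (2 * r₀)) hf1.continuous.continuousOn
  obtain ⟨K₂, hK₂⟩ := isCompact_Icc.exists_bound_of_continuousOn
    (s := Set.Icc (-(2 * r₀)) (2 * r₀)) hcf2.continuousOn
  set K := max (max K₁ K₂) (max 1 (2 * (2 * r₀))) with hKdef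
  have hK1 : 1 ≤ K := (le_max_left _ _).trans (le_max_right _ _)
  have hK0 : 0 < K := by linarith
  have hS0 : S 0 = 0 := ((hS 0 (Metric.mem_ball_self hr₀)).2.2 0
    ⟨by linarith, by linarith⟩ (by simp [hf'0])).symm
  have hcont : ContinuousAt (
      fun y : EuclideanSpace ℝ (Fin 2) => |y 1 - f (S y)| * (6 * K ^ 3)) 0 := by
    have hSc : ContinuousAt S 0 :=
      hS2.continuousOn.continuousAt (Metric.ball_mem_nhds _ hr₀)
    have : ContinuousAt (fun y => f (S y)) 0 :=
      ContinuousAt.comp (g := f) hdf.continuous.continuousAt hSc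
    have h1 : ContinuousAt (fun y : EuclideanSpace ℝ (Fin 2) => y 1) 0 :=
      (EuclideanSpace.proj (𝕜 := ℝ) (1 : Fin 2)).continuous.continuousAt
    exact (h1.sub this).abs.mul_const _
  have hev : ∀ᶠ y : EuclideanSpace ℝ (Fin 2) in 𝓝 0, |y 1 - f (S y)| * (6 * K ^ 3) < 1 / 4 :=
    hcont.eventually_lt_const (by simp [hS0, hf0])
  obtain ⟨ε, hε, hball⟩ := Metric.eventually_nhds_iff_ball.1 hev
  refine ⟨min ε r₀, 416 * (6 * K ^ 3) ^ 3, lt_min hε hr₀, min_le_right _ _, by positivity, ?_⟩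
  intro s hs y hy _ hne
  obtain ⟨hSy, hSeq, -⟩ := hS y (Metric.ball_subset_ball (min_le_right _ _) hy)
  have hsr := abs_le.1 (hs.trans (min_le_right _ _))
  have e0 : y 0 = S y - (y 1 - f (S y)) * deriv f (S y) := by linear_combination -hSeq
  have e1 : y 1 = f (S y) + (y 1 - f (S y)) := by ring
  have e0' : ystar y 0 = S y + (y 1 - f (S y)) * deriv f (S y) := by
    have : ystar y 0 = 2 * S y - y 0 := by simp [hystar, pt]
    linear_combination this - e0
  have e1' : ystar y 1 = f (S y) - (y 1 - f (S y)) := by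
    have : ystar y 1 = 2 * f (S y) - y 1 := by simp [hystar, pt]
    linear_combination this
  have hnorm : 0 < ‖pt s (f s) - y‖ := norm_pos_iff.2 (sub_ne_zero.2 hne.symm)
  have hsq := norm_pt_sub_sq s (f s) y
  have hroot : ‖pt s (f s) - y‖ = √((s - y 0) ^ 2 + (f s - y 1) ^ 2) := by
    rw [← hsq, Real.sqrt_sq hnorm.le]
  have hpos : 0 < (s - y 0) ^ 2 + (f s - y 1) ^ 2 := by rw [← hsq]; positivity
  have hl := (hball y (Metric.ball_subset_ball (min_le_left _ _) hy)).le
  simp only [log_norm_pt_sub, hroot, e0', e1']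
  generalize y 1 - f (S y) = l at *
  rw [e0, e1] at hpos ⊢
  exact abs_iteratedDeriv_two_log_reflection_le (M := 2 * r₀) (fun t => (hdf t).hasDerivAt)
    (fun t => (hdf1 t).hasDerivAt) hK1 ((le_max_right _ _).trans (le_max_right _ _))
    (fun t ht => ⟨(hK₁ t ht).trans ((le_max_left _ _).trans (le_max_left _ _)),
      (hK₂ t ht).trans ((le_max_right _ _).trans (le_max_left _ _))⟩)
    ⟨hSy.1.le, hSy.2.le⟩ ⟨by linarith, by linarith⟩ hl hpos
end
end
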